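/- arXiv:1606.00409 — 4 statements merged into one kernel-verified Lean document; each statement's English description precedes it below -/
import Mathlib

section
/- Let u be a diagonalizable unitary operator on ℓ²(ℕ, ℂ) (i.e., ℓ²(ℕ,ℂ) has an orthonormal basis of eigenvectors of u) such that for every complex number μ of modulus 1 the operator 1 − μu is not compact. Then there exist a complex number λ with |λ| = 1, a unitary operator g on ℓ²(ℕ, ℂ), and a sequence θ : ℕ → (−π, π] such that g (λu) g⁻¹ is the diagonal operator with entries (e^{iθ_n})_{n∈ℕ} with respect to the standard orthonormal basis, and for every n ∈ ℕ one has both |∑_{i=0}^{n} θ_i| ≤ sup_{j∈ℕ} |θ_j| and |∑_{i=0}^{n} θ_i| ≤ 2·ℓ(u). -/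
/- Statement 8: any diagonalizable unitary `u` on `ℓ²(ℕ, ℂ)` that is not congruent to a compact
perturbation of a scalar (i.e. `1 - μu` is never compact for `|μ| = 1`) has, after multiplying
by a suitable unimodular scalar and conjugating by a unitary, an angle sum ordered diagonal form
with partial angle sums bounded by `2·ℓ(u)`. -/

open Complex

noncomputable section

/-- `H = ℓ²(ℕ, ℂ)`. -/
abbrev H : Type := lp (fun _ : ℕ => ℂ) 2

/-- The standard orthonormal basis of `H`. -/
noncomputable def e (n : ℕ) : H := lp.single 2 n (1 : ℂ)

/-- `ℓ(x) = inf_{|λ| = 1} ‖1 - λ x‖` (operator norm). -/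
noncomputable def ell (x : H →L[ℂ] H) : ℝ :=
  ⨅ lam : {l : ℂ // ‖l‖ = 1}, ‖1 - (lam : ℂ) • x‖

theorem exists_next_index (θ : ℕ → ℝ) {M p q r : ℝ}
    (hup : {n | r ≤ θ n ∧ θ n ≤ p}.Infinite) (hdown : {n | r ≤ -θ n ∧ -θ n ≤ q}.Infinite)
    (hr : 0 < r)
    (hneg : ∀ n, θ n < 0 → p - θ n ≤ 2 * M) (hpos : ∀ n, 0 ≤ θ n → q + θ n ≤ 2 * M)
    (F : Finset ℕ) (hF : |∑ i ∈ F, θ i| ≤ M) :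
    ∃ n ∉ F, |(∑ i ∈ F, θ i) + θ n| ≤ M ∧
      ∀ v ∉ F, (∀ w < v, w ∈ F) → n = v ∨ (0 ≤ θ v ∧ θ n ≤ -r) ∨ (θ v < 0 ∧ r ≤ θ n) := by
  classical
  obtain ⟨v, hv, hmin⟩ : ∃ v ∉ F, ∀ w < v, w ∈ F := by
    have h := F.exists_notMem
    exact ⟨Nat.find h, Nat.find_spec h, fun w hw => not_not.1 (Nat.find_min h hw)⟩
  have huniq : ∀ w ∉ F, (∀ z < w, z ∈ F) → v = w := by
    intro w hw hw'
    rcases lt_trichotomy v w with h | h | h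
    · exact absurd (hw' v h) hv
    · exact h
    · exact absurd (hmin w h) hw
  rw [abs_le] at hF
  by_cases hfit : |(∑ i ∈ F, θ i) + θ v| ≤ M
  · exact ⟨v, hv, hfit, fun w hw hw' => Or.inl (huniq w hw hw')⟩
  rcases lt_or_ge (θ v) 0 with h0 | h0
  · obtain ⟨n, ⟨hn1, hn2⟩, hnF⟩ := hup.exists_notMem_finset F
    refine ⟨n, hnF, ?_, fun w hw hw' => Or.inr (Or.inr ?_)⟩
    · have h := hneg v h0
      rw [abs_le] at hfit ⊢
      constructor
      · linarith
      · by_contra hcon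
        exact hfit ⟨by linarith, by linarith⟩
    · rw [← huniq w hw hw']
      exact ⟨h0, hn1⟩
  · obtain ⟨n, ⟨hn1, hn2⟩, hnF⟩ := hdown.exists_notMem_finset F
    refine ⟨n, hnF, ?_, fun w hw hw' => Or.inr (Or.inl ?_)⟩
    · have h := hpos v h0
      rw [abs_le] at hfit ⊢
      constructor
      · by_contra hcon
        exact hfit ⟨by linarith, by linarith⟩
      · linarith
    · rw [← huniq w hw hw']
      exact ⟨h0, by linarith⟩

/-- Greedy rearrangement: infinitely many positive terms of controlled size and infinitely many
negative ones allow all partial sums to be kept in `[-M, M]`. -/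
theorem exists_equiv_abs_sum_le (θ : ℕ → ℝ) {M p q r : ℝ} (hM : 0 ≤ M) (hr : 0 < r)
    (hup : {n | r ≤ θ n ∧ θ n ≤ p}.Infinite) (hdown : {n | r ≤ -θ n ∧ -θ n ≤ q}.Infinite)
    (hneg : ∀ n, θ n < 0 → p - θ n ≤ 2 * M) (hpos : ∀ n, 0 ≤ θ n → q + θ n ≤ 2 * M) :
    ∃ σ : ℕ ≃ ℕ, ∀ n, |∑ k ∈ Finset.range n, θ (σ k)| ≤ M := by
  classical
  choose next hmem hsum hstep using exists_next_index θ hup hdown hr hneg hpos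
  let S : ℕ → {F : Finset ℕ // |∑ i ∈ F, θ i| ≤ M} := fun n =>
    Nat.rec ⟨∅, by simpa using hM⟩
      (fun _ F => ⟨insert (next F.1 F.2) F.1, by
        rw [Finset.sum_insert (hmem F.1 F.2), add_comm]; exact hsum F.1 F.2⟩) n
  let f : ℕ → ℕ := fun n => next (S n).1 (S n).2
  have hS : ∀ n, (S (n + 1)).1 = insert (f n) (S n).1 := fun n => rfl
  have hfS : ∀ n, f n ∉ (S n).1 := fun n => hmem _ _
  have hSf : ∀ n, (S n).1 = (Finset.range n).image f := by
    intro n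
    induction n with
    | zero => rfl
    | succ n ih => rw [hS, ih, Finset.range_add_one, Finset.image_insert]
  have hsumS : ∀ n, ∑ i ∈ (S n).1, θ i = ∑ k ∈ Finset.range n, θ (f k) := by
    intro n
    induction n with
    | zero => rfl
    | succ n ih => rw [hS, Finset.sum_insert (hfS n), Finset.sum_range_succ, ih, add_comm]
  have hbd : ∀ n, |∑ k ∈ Finset.range n, θ (f k)| ≤ M := fun n => hsumS n ▸ (S n).2
  have hlt : ∀ m n, m < n → f m ≠ f n := by
    intro m n hmn h
    apply hfS n
    rw [hSf, ← h]
    exact Finset.mem_image_of_mem f (Finset.mem_range.2 hmn)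
  have hinj : Function.Injective f := by
    intro m n h
    rcases lt_trichotomy m n with h' | h' | h'
    · exact absurd h (hlt m n h')
    · exact h'
    · exact absurd h.symm (hlt n m h')
  have hsurj : Function.Surjective f := by
    by_contra hns
    have hex : ∃ v, ∀ n, f n ≠ v := by simpa [Function.Surjective] using hns
    obtain ⟨v, hv, hmin⟩ : ∃ v, (∀ n, f n ≠ v) ∧ ∀ w < v, ∃ n, f n = w :=
      ⟨Nat.find hex, Nat.find_spec hex, fun w hw => by
        simpa using Nat.find_min hex hw⟩
    choose! g hg using hmin
    obtain ⟨N, hN⟩ : ∃ N, ∀ w < v, g w < N :=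
      ⟨(Finset.range v).sup g + 1, fun w hw =>
        Nat.lt_succ_of_le (Finset.le_sup (f := g) (Finset.mem_range.2 hw))⟩
    have hpend : ∀ n, N ≤ n → (0 ≤ θ v ∧ θ (f n) ≤ -r) ∨ (θ v < 0 ∧ r ≤ θ (f n)) := by
      intro n hn
      refine (hstep (S n).1 (S n).2 v ?_ ?_).resolve_left (hv n)
      · rw [hSf]
        simpa using fun k _ => hv k
      · intro w hw
        rw [hSf, ← hg w hw]
        exact Finset.mem_image_of_mem f (Finset.mem_range.2 ((hN w hw).trans_le hn))
    obtain ⟨K, hK⟩ := exists_nat_gt (2 * M / r)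
    rw [div_lt_iff₀ hr] at hK
    have hb := abs_le.1 (hbd N)
    have hb' := abs_le.1 (hbd (N + K))
    rw [Finset.sum_range_add] at hb'
    rcases lt_or_ge (θ v) 0 with h0 | h0
    · have := Finset.card_nsmul_le_sum (Finset.range K) (fun k => θ (f (N + k))) r
        fun k _ => ((hpend (N + k) (by omega)).resolve_left fun h => absurd h.1 (by linarith)).2
      simp only [Finset.card_range, nsmul_eq_mul] at this
      linarith
    · have := Finset.sum_le_card_nsmul (Finset.range K) (fun k => θ (f (N + k))) (-r)
        fun k _ => ((hpend (N + k) (by omega)).resolve_right fun h => absurd h.1 (by linarith)).2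
      simp only [Finset.card_range, nsmul_eq_mul] at this
      linarith
  exact ⟨Equiv.ofBijective f ⟨hinj, hsurj⟩, hbd⟩

open Filter Topology in
theorem exists_shift_of_nonneg (α : ℕ → ℝ) {a x y : ℝ} (ha : a ≤ Real.pi) (hα : ∀ n, |α n| ≤ a)
    (hxy : x < y) (hx0 : 0 ≤ x) (hya : y ≤ a)
    (hx : MapClusterPt x atTop α) (hy : MapClusterPt y atTop α) :
    ∃ s : ℝ, ∀ θ : ℕ → ℝ, (∀ n, |θ n| ≤ Real.pi) →
      (∀ n, ∃ k : ℤ, θ n = α n - s + k * (2 * Real.pi)) →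
      ∃ σ : ℕ ≃ ℕ, ∀ n, |∑ k ∈ Finset.range n, θ (σ k)| ≤ a := by
  have hpi := Real.pi_pos
  obtain ⟨q, hq0, hqa, hqy, hqpi⟩ : ∃ q : ℝ, 0 < q ∧ q ≤ a ∧ q < y - x ∧
      (Real.pi < 2 * a → q ≤ 2 * a - Real.pi) := by
    by_cases h : Real.pi < 2 * a
    · refine ⟨min ((y - x) / 2) (2 * a - Real.pi), ?_, ?_, ?_, fun _ => min_le_right _ _⟩
      · exact lt_min (by linarith) (by linarith)
      · exact (min_le_left _ _).trans (by linarith)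
      · exact (min_le_left _ _).trans_lt (by linarith)
    · exact ⟨(y - x) / 2, by linarith, by linarith, by linarith, fun h' => absurd h' h⟩
  have hinf : ∀ z ε, 0 < ε → MapClusterPt z atTop α → {n | |α n - z| < ε}.Infinite := by
    intro z ε hε hz
    refine Nat.frequently_atTop_iff_infinite.1 ?_
    exact hz.frequently (Metric.ball_mem_nhds z hε)
  set s := x + q / 2 with hs
  refine ⟨s, fun θ hθ hk => ?_⟩
  have hcases : ∀ n, θ n = α n - s ∨
      (θ n = α n - s + 2 * Real.pi ∧ 0 ≤ θ n ∧ α n - s ≤ -Real.pi ∧ Real.pi < 2 * a) := by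
    intro n
    obtain ⟨k, hk⟩ := hk n
    have h1 := abs_le.1 (hα n)
    have h2 := abs_le.1 (hθ n)
    have hk1 : -1 < k := by
      by_contra hcon
      have : (k : ℝ) ≤ -1 := by exact_mod_cast not_lt.1 hcon
      nlinarith
    have hk2 : k < 2 := by
      by_contra hcon
      have : (2 : ℝ) ≤ k := by exact_mod_cast not_lt.1 hcon
      nlinarith
    obtain rfl | rfl : k = 0 ∨ k = 1 := by omega
    · left; simpa using hk
    · right
      push_cast at hk
      exact ⟨by linarith, by linarith, by linarith, by linarith⟩
  refine exists_equiv_abs_sum_le θ (p := a - s) (q := q) (r := min (q / 4) ((y - s) / 2))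
    (by linarith) (lt_min (by linarith) (by linarith)) ?_ ?_ ?_ ?_
  · refine (hinf y ((y - s) / 2) (by linarith) hy).mono fun n hn => ?_
    obtain ⟨hn1, hn2⟩ := abs_lt.1 (Set.mem_ofPred.1 hn)
    have h1 := abs_le.1 (hα n)
    rcases hcases n with h | h
    · rw [Set.mem_ofPred_eq, h]
      exact ⟨(min_le_right _ _).trans (by linarith), by linarith⟩
    · linarith [h.2.2.1]
  · refine (hinf x (q / 4) (by linarith) hx).mono fun n hn => ?_
    obtain ⟨hn1, hn2⟩ := abs_lt.1 (Set.mem_ofPred.1 hn)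
    rcases hcases n with h | h
    · rw [Set.mem_ofPred_eq, h]
      exact ⟨(min_le_left _ _).trans (by linarith), by linarith⟩
    · linarith [h.2.2.1]
  · intro n hn
    have h1 := abs_le.1 (hα n)
    rcases hcases n with h | h
    · linarith
    · linarith [h.2.1]
  · intro n hn
    have h1 := abs_le.1 (hα n)
    rcases hcases n with h | h
    · linarith
    · linarith [hqpi h.2.2.2, (abs_le.1 (hθ n)).2]

open Filter Topology in
theorem exists_shift_abs_sum_le (α : ℕ → ℝ) {a : ℝ} (ha : a ≤ Real.pi) (hα : ∀ n, |α n| ≤ a)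
    (hαpi : ∀ n, α n ∈ Set.Ioc (-Real.pi) Real.pi) (hlim : ∀ x, ¬ Tendsto α atTop (𝓝 x)) :
    ∃ s : ℝ, ∀ θ : ℕ → ℝ, (∀ n, θ n ∈ Set.Ioc (-Real.pi) Real.pi) →
      (∀ n, ∃ k : ℤ, θ n = α n - s + k * (2 * Real.pi)) →
      ∃ σ : ℕ ≃ ℕ, ∀ n, |∑ k ∈ Finset.range n, θ (σ k)| ≤ a := by
  have hpi := Real.pi_pos
  have hmem : ∀ n, α n ∈ Set.Icc (-a) a := fun n => abs_le.1 (hα n)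
  have hcpt : IsCompact (Set.Icc (-a) a) := isCompact_Icc
  obtain ⟨x, y, hxy, hxa, hya, hx, hy⟩ : ∃ x y, x < y ∧ -a ≤ x ∧ y ≤ a ∧
      MapClusterPt x atTop α ∧ MapClusterPt y atTop α := by
    obtain ⟨x, hxa, hx⟩ := hcpt.exists_mapClusterPt_of_frequently
      (l := atTop) (f := α) (Eventually.of_forall hmem).frequently
    obtain ⟨y, hya, hy, hne⟩ : ∃ y ∈ Set.Icc (-a) a, MapClusterPt y atTop α ∧ y ≠ x := by
      by_contra! hcon
      exact hlim x (hcpt.tendsto_nhds_of_unique_mapClusterPt (Eventually.of_forall hmem) hcon)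
    rcases hne.lt_or_gt with h | h
    · exact ⟨y, x, h, hya.1, hxa.2, hy, hx⟩
    · exact ⟨x, y, h, hxa.1, hya.2, hx, hy⟩
  rcases le_or_gt 0 x with hx0 | hx0
  · obtain ⟨s, hs⟩ := exists_shift_of_nonneg α ha hα hxy hx0 hya hx hy
    exact ⟨s, fun θ hθ => hs θ fun n => abs_le.2 ⟨(hθ n).1.le, (hθ n).2⟩⟩
  rcases le_or_gt y 0 with hy0 | hy0
  · have hcneg : ∀ {z}, MapClusterPt z atTop α → MapClusterPt (-z) atTop (fun n => -α n) :=
      fun h => h.continuousAt_comp continuous_neg.continuousAt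
    obtain ⟨s, hs⟩ := exists_shift_of_nonneg (fun n => -α n) ha (by simpa using hα)
      (neg_lt_neg hxy) (by linarith) (by linarith) (hcneg hy) (hcneg hx)
    refine ⟨-s, fun θ hθ hk => ?_⟩
    obtain ⟨σ, hσ⟩ := hs (fun n => -θ n)
      (fun n => by rw [abs_neg]; exact abs_le.2 ⟨(hθ n).1.le, (hθ n).2⟩)
      (fun n => by
        obtain ⟨k, hk⟩ := hk n
        exact ⟨-k, by rw [hk]; push_cast; ring⟩)
    exact ⟨σ, fun n => by simpa using hσ n⟩
  · refine ⟨0, fun θ hθ hk => ?_⟩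
    obtain rfl : θ = α := by
      funext n
      obtain ⟨k, hk⟩ := hk n
      have h1 := hθ n
      have h2 := hαpi n
      have hk1 : -1 < k := by
        by_contra hcon
        have : (k : ℝ) ≤ -1 := by exact_mod_cast not_lt.1 hcon
        nlinarith [h1.1, h2.2]
      have hk2 : k < 1 := by
        by_contra hcon
        have : (1 : ℝ) ≤ k := by exact_mod_cast not_lt.1 hcon
        nlinarith [h1.2, h2.1]
      obtain rfl : k = 0 := by omega
      simpa using hk
    refine exists_equiv_abs_sum_le θ (p := a) (q := a) (r := min (y / 2) (-x / 2))
      (by linarith) (lt_min (by linarith) (by linarith)) ?_ ?_ ?_ ?_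
    · refine (Nat.frequently_atTop_iff_infinite.1
        (hy.frequently (lt_mem_nhds (half_lt_self hy0)))).mono fun n hn => ?_
      exact ⟨(min_le_left _ _).trans (le_of_lt hn), (hmem n).2⟩
    · refine (Nat.frequently_atTop_iff_infinite.1
        (hx.frequently (gt_mem_nhds (show x < x / 2 by linarith)))).mono fun n hn => ?_
      have hn : θ n < x / 2 := hn
      exact ⟨(min_le_right _ _).trans (by linarith), by linarith [(hmem n).1]⟩
    · intro n _
      linarith [(hmem n).1]
    · intro n _
      linarith [(hmem n).2]

section Diagonal

variable {E : Type*} [NormedAddCommGroup E] [InnerProductSpace ℂ E]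

theorem HilbertBasis.repr_apply_of_diagonal {ι : Type*} (b : HilbertBasis ι ℂ E) (T : E →L[ℂ] E)
    (c : ι → ℂ) (hT : ∀ i, T (b i) = c i • b i) (x : E) (i : ι) :
    b.repr (T x) i = c i * b.repr x i := by
  classical
  rw [b.repr_apply_apply]
  have h := (b.hasSum_repr x).mapL (innerSL ℂ (b i) ∘L T)
  refine h.unique ?_
  convert! hasSum_ite_eq i (c i * b.repr x i) using 2 with j
  have := orthonormal_iff_ite.1 b.orthonormal i j
  simp only [ContinuousLinearMap.comp_apply, map_smul, hT, innerSL_apply_apply, this, smul_eq_mul]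
  by_cases hij : i = j
  · subst hij; simp [mul_comm]
  · simp [hij, Ne.symm hij]

theorem HilbertBasis.opNorm_le_of_diagonal {ι : Type*} (b : HilbertBasis ι ℂ E) (T : E →L[ℂ] E)
    (c : ι → ℂ) (hT : ∀ i, T (b i) = c i • b i) {C : ℝ} (hC : 0 ≤ C) (h : ∀ i, ‖c i‖ ≤ C) :
    ‖T‖ ≤ C := by
  refine T.opNorm_le_bound hC fun x => ?_
  rw [← b.repr.norm_map (T x), ← b.repr.norm_map x, ← Complex.norm_of_nonneg hC, ← norm_smul]
  refine lp.norm_mono two_ne_zero fun i => ?_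
  rw [b.repr_apply_of_diagonal T c hT, lp.coeFn_smul, Pi.smul_apply, norm_mul, norm_smul,
    Complex.norm_of_nonneg hC]
  exact mul_le_mul_of_nonneg_right (h i) (norm_nonneg _)

open Filter Topology in
theorem HilbertBasis.isCompactOperator_of_diagonal [CompleteSpace E] (b : HilbertBasis ℕ ℂ E)
    (T : E →L[ℂ] E) (c : ℕ → ℂ) (hT : ∀ i, T (b i) = c i • b i) (hc : Tendsto c atTop (𝓝 0)) :
    IsCompactOperator T := by
  let F : ℕ → E →L[ℂ] E := fun N =>
    ∑ i ∈ Finset.range N, c i • (innerSL ℂ (b i)).smulRight (b i)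
  have hF : ∀ N, IsCompactOperator (F N) := fun N =>
    (compactOperator (RingHom.id ℂ) E E).sum_mem fun i _ =>
      Submodule.smul_mem _ (c i)
        ((isCompactOperator_of_locallyCompactSpace_dom (innerSL ℂ (b i))).clm_comp
          (ContinuousLinearMap.toSpanSingleton ℂ (b i)))
  have hFb : ∀ N j, (T - F N) (b j) = (if j < N then 0 else c j) • b j := by
    intro N j
    simp only [F, sub_apply, sum_apply,
      smul_apply, ContinuousLinearMap.smulRight_apply, innerSL_apply_apply,
      orthonormal_iff_ite.1 b.orthonormal, hT]
    by_cases h : j < N <;> simp [h]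
  refine isCompactOperator_of_tendsto (F := F) (l := atTop) ?_ (Eventually.of_forall hF)
  rw [Metric.tendsto_atTop] at hc ⊢
  intro ε hε
  obtain ⟨N, hN⟩ := hc (ε / 2) (half_pos hε)
  refine ⟨N, fun n hn => ?_⟩
  rw [dist_comm, dist_eq_norm]
  refine (b.opNorm_le_of_diagonal _ _ (hFb n) (half_pos hε).le fun j => ?_).trans_lt
    (half_lt_self hε)
  split_ifs with h
  · simpa using (half_pos hε).le
  · simpa using (hN j (by omega)).le

theorem HilbertBasis.exists_reindex {ι κ : Type*} [CompleteSpace E] (b : HilbertBasis ι ℂ E)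
    (σ : κ ≃ ι) : ∃ b' : HilbertBasis κ ℂ E, ∀ k, b' k = b (σ k) := by
  have hrange : Set.range (b ∘ σ) = Set.range b := σ.surjective.range_comp b
  refine ⟨HilbertBasis.mk (b.orthonormal.comp σ σ.injective) ?_, fun k => ?_⟩
  · rw [hrange, b.dense_span]
  · rw [HilbertBasis.coe_mk, Function.comp_apply]

end Diagonal

theorem norm_one_sub_exp_mul_I (t : ℝ) (ht : |t| ≤ Real.pi) :
    ‖1 - exp (t * I)‖ = 2 * Real.sin (|t| / 2) := by
  have hpi := Real.pi_pos
  have h0 : 0 ≤ Real.sin (|t| / 2) :=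
    Real.sin_nonneg_of_nonneg_of_le_pi (by positivity) (by linarith)
  rw [norm_sub_rev, mul_comm, norm_exp_I_mul_ofReal_sub_one, norm_mul, Real.norm_ofNat,
    Real.norm_eq_abs]
  congr 1
  rcases abs_cases t with ⟨h, _⟩ | ⟨h, _⟩
  · rw [h] at h0 ⊢
    exact abs_of_nonneg h0
  · rw [h] at h0 ⊢
    rw [neg_div, Real.sin_neg] at h0 ⊢
    exact abs_of_nonpos (by linarith)

theorem ell_le (u : H →L[ℂ] H) {l : ℂ} (hl : ‖l‖ = 1) : ell u ≤ ‖1 - l • u‖ :=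
  ciInf_le (f := fun m : {m : ℂ // ‖m‖ = 1} => ‖1 - (m : ℂ) • u‖)
    ⟨0, by rintro _ ⟨m, rfl⟩; exact norm_nonneg _⟩ ⟨l, hl⟩

theorem exists_norm_one_sub_smul_eq_ell (u : H →L[ℂ] H) :
    ∃ l : ℂ, ‖l‖ = 1 ∧ ‖1 - l • u‖ = ell u := by
  obtain ⟨l, hl, hmin⟩ := (isCompact_sphere (0 : ℂ) 1).exists_isMinOn
    (NormedSpace.sphere_nonempty.2 zero_le_one)
    (f := fun l : ℂ => ‖1 - l • u‖) (by fun_prop)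
  have hl : ‖l‖ = 1 := by simpa using hl
  refine ⟨l, hl, le_antisymm ?_ ?_⟩
  · have : Nonempty {l : ℂ // ‖l‖ = 1} := ⟨⟨l, hl⟩⟩
    exact le_ciInf fun m => hmin (by simpa using m.2)
  · exact ell_le u hl

theorem exists_angle_sum_ordered_conjugate
    (u : H →L[ℂ] H) (hu : u ∈ unitary (H →L[ℂ] H))
    (hdiag : ∃ (b : HilbertBasis ℕ ℂ H) (μ : ℕ → ℂ), ∀ n, u (b n) = μ n • b n)
    (hnc : ∀ μ : ℂ, ‖μ‖ = 1 → ¬ IsCompactOperator (⇑((1 : H →L[ℂ] H) - μ • u))) :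
    ∃ lam : ℂ, ‖lam‖ = 1 ∧
      ∃ g : H →L[ℂ] H, g ∈ unitary (H →L[ℂ] H) ∧
        ∃ θ : ℕ → ℝ,
          (∀ n, θ n ∈ Set.Ioc (-Real.pi) Real.pi) ∧
          (∀ n, (g * (lam • u) * star g) (e n) =
            Complex.exp ((θ n : ℝ) * Complex.I) • e n) ∧
          (∀ n, |∑ k ∈ Finset.range (n + 1), θ k| ≤ ⨆ j : ℕ, |θ j|) ∧
          (∀ n, |∑ k ∈ Finset.range (n + 1), θ k| ≤ 2 * ell u) := by
  obtain ⟨b, μ, hb⟩ := hdiag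
  have hbn : ∀ n, ‖b n‖ = 1 := b.orthonormal.1
  have hμ : ∀ n, ‖μ n‖ = 1 := fun n => by
    have h := u.norm_map_of_mem_unitary hu (b n)
    rwa [hb, norm_smul, hbn, mul_one] at h
  have hsub : ∀ (l : ℂ) n, ((1 : H →L[ℂ] H) - l • u) (b n) = (1 - l * μ n) • b n := fun l n => by
    simp [hb, sub_smul, mul_smul]
  have hexp : ∀ z : ℂ, ‖z‖ = 1 → exp (arg z * I) = z := fun z hz => by
    simpa [hz] using norm_mul_exp_arg_mul_I z
  obtain ⟨l, hl, hell⟩ := exists_norm_one_sub_smul_eq_ell u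
  have hlμ : ∀ n, ‖l * μ n‖ = 1 := fun n => by rw [norm_mul, hl, hμ, one_mul]
  set α : ℕ → ℝ := fun n => arg (l * μ n) with hα
  have hαexp : ∀ n, exp (α n * I) = l * μ n := fun n => hexp _ (hlμ n)
  have hαle : ∀ n, 2 * Real.sin (|α n| / 2) ≤ ell u := fun n => by
    rw [← norm_one_sub_exp_mul_I _ (abs_arg_le_pi _), hαexp, ← hell]
    have h := ((1 : H →L[ℂ] H) - l • u).le_opNorm (b n)
    rwa [hsub, norm_smul, hbn, mul_one, mul_one] at h
  have hbdd : BddAbove (Set.range fun n => |α n|) :=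
    ⟨Real.pi, by rintro _ ⟨n, rfl⟩; exact abs_arg_le_pi _⟩
  have hlim : ∀ x, ¬ Filter.Tendsto α Filter.atTop (nhds x) := by
    intro x hx
    refine hnc ((exp (x * I))⁻¹ * l) (by simp [hl, norm_exp_ofReal_mul_I]) ?_
    refine b.isCompactOperator_of_diagonal _ _ (hsub _) ?_
    have h : Filter.Tendsto (fun n => 1 - (exp (x * I))⁻¹ * exp (α n * I)) Filter.atTop
        (nhds (1 - (exp (x * I))⁻¹ * exp (x * I))) := by
      have hcont : Continuous fun t : ℝ => 1 - (exp (x * I))⁻¹ * exp (t * I) := by fun_prop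
      exact (hcont.tendsto x).comp hx
    simpa [hαexp, mul_assoc] using h
  obtain ⟨s, hs⟩ := exists_shift_abs_sum_le α (a := ⨆ n, |α n|)
    (ciSup_le fun n => abs_arg_le_pi _) (le_ciSup hbdd) (fun n => arg_mem_Ioc _) hlim
  set m : ℂ := exp (-(s * I)) * l with hm
  have hmn : ‖m‖ = 1 := by
    rw [hm, norm_mul, hl, mul_one, ← neg_mul, ← ofReal_neg, norm_exp_ofReal_mul_I]
  have hθexp : ∀ n, exp (arg (m * μ n) * I) = m * μ n := fun n =>
    hexp _ (by rw [norm_mul, hmn, hμ, one_mul])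
  obtain ⟨σ, hσ⟩ := hs (fun n => arg (m * μ n)) (fun n => arg_mem_Ioc _) fun n => by
    have h : exp (arg (m * μ n) * I) = exp ((α n - s : ℝ) * I) := by
      rw [hθexp, hm, mul_assoc, ← hαexp, ← exp_add]
      congr 1
      push_cast
      ring
    obtain ⟨k, hk⟩ := exp_eq_exp_iff_exists_int.1 h
    refine ⟨k, ?_⟩
    have := congrArg im hk
    simpa using this
  obtain ⟨b', hb'⟩ := b.exists_reindex σ
  set g := Unitary.linearIsometryEquiv.symm b'.repr with hg
  have hge : ∀ n, (g : H →L[ℂ] H) (b' n) = e n := fun n => by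
    rw [hg, Unitary.coe_symm_linearIsometryEquiv_apply]
    exact b'.repr_self n
  have hstar : ∀ n, (star (g : H →L[ℂ] H)) (e n) = b' n := fun n => by
    rw [← hge, ← mul_apply_eq_comp, Unitary.star_mul_self_of_mem g.2,
      one_apply_eq_self]
  refine ⟨m, hmn, g, g.2, fun n => arg (m * μ (σ n)), fun n => arg_mem_Ioc _, fun n => ?_,
    fun n => (hσ (n + 1)).trans ?_, fun n => (hσ (n + 1)).trans ?_⟩
  · rw [hθexp, mul_apply_eq_comp, mul_apply_eq_comp, hstar,
      smul_apply, hb', hb, smul_smul, map_smul, ← hb', hge]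
  · set T := ⨆ j, |arg (m * μ (σ j))| with hT
    have hle : ∀ n, |arg (m * μ n)| ≤ T := fun n => by
      have hbd : BddAbove (Set.range fun j => |arg (m * μ (σ j))|) :=
        ⟨Real.pi, by rintro _ ⟨n, rfl⟩; exact abs_arg_le_pi _⟩
      simpa using le_ciSup hbd (σ.symm n)
    have hTpi : T ≤ Real.pi := ciSup_le fun n => abs_arg_le_pi _
    have hT0 : 0 ≤ T := Real.iSup_nonneg fun n => abs_nonneg _
    have hpi := Real.pi_pos
    have hellT : ell u ≤ 2 * Real.sin (T / 2) := by
      refine (ell_le u hmn).trans (b.opNorm_le_of_diagonal _ _ (hsub m) ?_ fun n => ?_)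
      · exact mul_nonneg zero_le_two
          (Real.sin_nonneg_of_nonneg_of_le_pi (by positivity) (by linarith))
      · rw [← hθexp, norm_one_sub_exp_mul_I _ (abs_arg_le_pi _)]
        have := Real.sin_le_sin_of_le_of_le_pi_div_two
          (x := |arg (m * μ n)| / 2) (y := T / 2)
          (by linarith [abs_nonneg (arg (m * μ n))]) (by linarith) (by linarith [hle n])
        linarith
    refine ciSup_le fun n => ?_
    by_contra! hlt
    have hαpi : |α n| ≤ Real.pi := abs_arg_le_pi _
    have := Real.sin_lt_sin_of_lt_of_le_pi_div_two (x := T / 2) (y := |α n| / 2)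
      (by linarith) (by linarith) (by linarith)
    linarith [hαle n]
  · refine ciSup_le fun n => ?_
    have hαpi : |α n| ≤ Real.pi := abs_arg_le_pi _
    have hpi := Real.pi_pos
    have h := Real.mul_le_sin (x := |α n| / 2) (by positivity) (by linarith)
    have h4 : 1 / 2 ≤ 2 / Real.pi := by
      rw [div_le_div_iff₀ two_pos hpi]
      linarith [Real.pi_le_four]
    have := mul_le_mul_of_nonneg_right h4 (show 0 ≤ |α n| / 2 by positivity)
    linarith [hαle n]
end
end

section
/- Let (θ_n)_{n∈ℕ} be a sequence of real numbers with ∑_{n∈ℕ} |θ_n| = ∞. Then there exist sequences (θ'_n) and (θ''_n) of real numbers such that: θ_n = θ'_n + θ''_n for all n; max(|θ'_n|, |θ''_n|) ≤ 2|θ_n| for all n; and for each of the two sequences (θ'_n) and (θ''_n), the set of indices with positive terms and the set of indices with negative terms are both infinite, the sum of the positive terms diverges to +∞, and the sum of the negative terms diverges to −∞. -/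
/- Statement 9: a real sequence `θ` with `∑ |θ_n| = ∞` splits as `θ = θ' + θ''` with
`max(|θ'_n|, |θ''_n|) ≤ 2|θ_n|`, where each of `θ'`, `θ''` has infinitely many positive and
negative terms, positive part summing to `+∞` and negative part summing to `-∞`. -/

/-- The sequence `β` has infinitely many positive and infinitely many negative terms, its
positive terms sum to `+∞` and its negative terms sum to `-∞`. -/
def BothSidedDivergence (β : ℕ → ℝ) : Prop :=
  {n : ℕ | 0 < β n}.Infinite ∧ {n : ℕ | β n < 0}.Infinite ∧
    (∀ C : ℝ, ∃ F : Finset ℕ, (∀ n ∈ F, 0 < β n) ∧ C < ∑ n ∈ F, β n) ∧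
    (∀ C : ℝ, ∃ F : Finset ℕ, (∀ n ∈ F, β n < 0) ∧ (∑ n ∈ F, β n) < C)

/-- A sequence whose positive and negative terms both have unbounded sums diverges on both
sides. -/
theorem bothSidedDivergence_of_unbounded {β : ℕ → ℝ}
    (hpos : ∀ C : ℝ, ∃ F : Finset ℕ, (∀ n ∈ F, 0 < β n) ∧ C < ∑ n ∈ F, β n)
    (hneg : ∀ C : ℝ, ∃ F : Finset ℕ, (∀ n ∈ F, β n < 0) ∧ (∑ n ∈ F, β n) < C) :
    BothSidedDivergence β := by
  refine ⟨fun hfin => ?_, fun hfin => ?_, hpos, hneg⟩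
  · obtain ⟨F, hF, hlt⟩ := hpos (∑ n ∈ hfin.toFinset, β n)
    refine hlt.not_ge (Finset.sum_le_sum_of_subset_of_nonneg (fun n hn => ?_) fun n hn _ => ?_)
    · simpa using hF n hn
    · exact le_of_lt (by simpa using hn)
  · obtain ⟨F, hF, hlt⟩ := hneg (∑ n ∈ hfin.toFinset, β n)
    refine hlt.not_ge (neg_le_neg_iff.1 ?_)
    rw [← Finset.sum_neg_distrib, ← Finset.sum_neg_distrib]
    refine Finset.sum_le_sum_of_subset_of_nonneg (fun n hn => ?_) fun n hn _ => ?_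
    · simpa using hF n hn
    · exact neg_nonneg.2 (le_of_lt (by simpa using hn))

theorem BothSidedDivergence.neg {β : ℕ → ℝ} (h : BothSidedDivergence β) :
    BothSidedDivergence (-β) := by
  obtain ⟨-, -, hpos, hneg⟩ := h
  refine bothSidedDivergence_of_unbounded (fun C => ?_) (fun C => ?_)
  · obtain ⟨F, hF, hlt⟩ := hneg (-C)
    exact ⟨F, by simpa using hF, by simpa using lt_neg_of_lt_neg hlt⟩
  · obtain ⟨F, hF, hlt⟩ := hpos (-C)
    exact ⟨F, by simpa using hF, by simpa using neg_lt_of_neg_lt hlt⟩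

/-- The pair of sums obtained by adding each successive term of `f` to the smaller one. -/
noncomputable def greedySums (f : ℕ → ℝ) : ℕ → ℝ × ℝ
  | 0 => (0, 0)
  | n + 1 =>
    if (greedySums f n).1 ≤ (greedySums f n).2 then
      ((greedySums f n).1 + f n, (greedySums f n).2)
    else ((greedySums f n).1, (greedySums f n).2 + f n)

theorem greedySums_add (f : ℕ → ℝ) (n : ℕ) :
    (greedySums f n).1 + (greedySums f n).2 = ∑ i ∈ Finset.range n, f i := by
  induction n with
  | zero => simp [greedySums]
  | succ n ih =>
    rw [Finset.sum_range_succ, ← ih, greedySums]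
    split_ifs <;> ring

/-- Two sequences with divergent total, the first of which absorbs all growth whenever it is
below the second, cannot have the first bounded. -/
theorem exists_lt_of_absorbs {a b S : ℕ → ℝ} (hS : Filter.Tendsto S Filter.atTop Filter.atTop)
    (hab : ∀ n, a n + b n = S n) (hb : ∀ n, a n < b n → b (n + 1) = b n) (C : ℝ) :
    ∃ n, C < a n := by
  by_contra! h
  obtain ⟨N, hN⟩ := Filter.eventually_atTop.1 (hS.eventually_gt_atTop (2 * C))
  have hconst : ∀ n, N ≤ n → b n = b N := by
    intro n hn
    induction n, hn using Nat.le_induction with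
    | base => rfl
    | succ n hn ih => rw [hb n (by linarith [h n, hab n, hN n hn]), ih]
  obtain ⟨n, hn, hnN⟩ := ((hS.eventually_gt_atTop (C + b N)).and
    (Filter.eventually_ge_atTop N)).exists
  linarith [h n, hab n, hconst n hnN]

theorem exists_set_unbounded_sums {f : ℕ → ℝ}
    (hS : Filter.Tendsto (fun N => ∑ n ∈ Finset.range N, f n) Filter.atTop Filter.atTop) :
    ∃ A : Set ℕ, (∀ C : ℝ, ∃ F : Finset ℕ, (∀ n ∈ F, n ∈ A) ∧ C < ∑ n ∈ F, f n) ∧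
      (∀ C : ℝ, ∃ F : Finset ℕ, (∀ n ∈ F, n ∉ A) ∧ C < ∑ n ∈ F, f n) := by
  classical
  set A : Set ℕ := {n | (greedySums f n).1 ≤ (greedySums f n).2} with hA
  have hfst : ∀ n, (greedySums f n).1 = ∑ i ∈ Finset.range n with i ∈ A, f i := by
    intro n
    induction n with
    | zero => simp [greedySums]
    | succ n ih =>
      rw [Finset.sum_filter, Finset.sum_range_succ, ← Finset.sum_filter, ← ih, greedySums]
      simp only [hA, Set.mem_ofPred_eq]
      split_ifs <;> simp
  have hsnd : ∀ n, (greedySums f n).2 = ∑ i ∈ Finset.range n with i ∉ A, f i := by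
    intro n
    have := Finset.sum_filter_add_sum_filter_not (Finset.range n) (· ∈ A) f
    linarith [hfst n, greedySums_add f n]
  refine ⟨A, fun C => ?_, fun C => ?_⟩
  · obtain ⟨n, hn⟩ := exists_lt_of_absorbs hS (greedySums_add f)
      (fun n h => by rw [greedySums, if_pos h.le]) C
    exact ⟨_, fun i hi => (Finset.mem_filter.1 hi).2, hfst n ▸ hn⟩
  · obtain ⟨n, hn⟩ := exists_lt_of_absorbs hS
      (fun n => (add_comm _ _).trans (greedySums_add f n))
      (fun n h => by rw [greedySums, if_neg h.not_ge]) C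
    exact ⟨_, fun i hi => (Finset.mem_filter.1 hi).2, hsnd n ▸ hn⟩

theorem bothSidedDivergence_of_eqOn {θ β : ℕ → ℝ} {A B : Set ℕ}
    (hA : ∀ C : ℝ, ∃ F : Finset ℕ, (∀ n ∈ F, n ∈ A) ∧ C < ∑ n ∈ F, (θ n)⁺)
    (hB : ∀ C : ℝ, ∃ F : Finset ℕ, (∀ n ∈ F, n ∈ B) ∧ C < ∑ n ∈ F, (θ n)⁺)
    (hβA : ∀ n ∈ A, β n = 2 * θ n) (hβB : ∀ n ∈ B, β n = -θ n) :
    BothSidedDivergence β := by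
  have hsum : ∀ F : Finset ℕ, ∑ n ∈ F, (θ n)⁺ = ∑ n ∈ F with 0 < θ n, θ n := by
    intro F
    rw [Finset.sum_filter]
    refine Finset.sum_congr rfl fun n _ => ?_
    split_ifs with h
    · exact posPart_of_nonneg h.le
    · exact posPart_of_nonpos (not_lt.1 h)
  refine bothSidedDivergence_of_unbounded (fun C => ?_) (fun C => ?_)
  · obtain ⟨F, hF, hlt⟩ := hA (C / 2)
    refine ⟨F.filter (0 < θ ·), fun n hn => ?_, ?_⟩
    · rw [Finset.mem_filter] at hn
      linarith [hβA n (hF n hn.1)]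
    · rw [Finset.sum_congr rfl fun n hn => hβA n (hF n (Finset.mem_filter.1 hn).1),
        ← Finset.mul_sum, ← hsum]
      linarith
  · obtain ⟨F, hF, hlt⟩ := hB (-C)
    refine ⟨F.filter (0 < θ ·), fun n hn => ?_, ?_⟩
    · rw [Finset.mem_filter] at hn
      linarith [hβB n (hF n hn.1)]
    · rw [Finset.sum_congr rfl fun n hn => hβB n (hF n (Finset.mem_filter.1 hn).1),
        Finset.sum_neg_distrib, ← hsum]
      linarith

theorem exists_splitting_of_not_summable_posPart {θ : ℕ → ℝ}
    (hθ : ¬ Summable fun n => (θ n)⁺) :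
    ∃ θ' θ'' : ℕ → ℝ,
      (∀ n, θ n = θ' n + θ'' n) ∧
      (∀ n, max |θ' n| |θ'' n| ≤ 2 * |θ n|) ∧
      BothSidedDivergence θ' ∧ BothSidedDivergence θ'' := by
  classical
  obtain ⟨A, hA, hB⟩ := exists_set_unbounded_sums
    ((not_summable_iff_tendsto_nat_atTop_of_nonneg fun n => posPart_nonneg (θ n)).1 hθ)
  refine ⟨fun n => if n ∈ A then 2 * θ n else -θ n, fun n => if n ∈ A then -θ n else 2 * θ n,
    fun n => ?_, fun n => ?_, ?_, ?_⟩
  · dsimp only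
    split_ifs <;> ring
  · dsimp only
    split_ifs <;> simp [abs_mul] <;> linarith [abs_nonneg (θ n)]
  · exact bothSidedDivergence_of_eqOn (B := Aᶜ) hA hB (fun n hn => if_pos hn)
      (fun n hn => if_neg hn)
  · exact bothSidedDivergence_of_eqOn (A := Aᶜ) hB hA (fun n hn => if_neg hn)
      (fun n hn => if_pos hn)

theorem exists_two_sided_divergent_splitting
    (θ : ℕ → ℝ)
    (hθ : Filter.Tendsto (fun N => ∑ n ∈ Finset.range N, |θ n|) Filter.atTop Filter.atTop) :
    ∃ θ' θ'' : ℕ → ℝ,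
      (∀ n, θ n = θ' n + θ'' n) ∧
      (∀ n, max |θ' n| |θ'' n| ≤ 2 * |θ n|) ∧
      BothSidedDivergence θ' ∧ BothSidedDivergence θ'' := by
  by_cases hpos : Summable fun n => (θ n)⁺
  · have hneg : ¬ Summable fun n => ((-θ) n)⁺ := fun hneg =>
      (not_summable_iff_tendsto_nat_atTop_of_nonneg fun n => abs_nonneg (θ n)).2 hθ <|
        (hpos.add hneg).congr fun n => by
          rw [Pi.neg_apply, posPart_neg, posPart_add_negPart]
    obtain ⟨θ', θ'', hadd, hle, h', h''⟩ := exists_splitting_of_not_summable_posPart hneg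
    refine ⟨-θ', -θ'', fun n => ?_, fun n => ?_, h'.neg, h''.neg⟩
    · have := hadd n
      simp only [Pi.neg_apply] at this ⊢
      linarith
    · simpa only [Pi.neg_apply, abs_neg] using hle n
  · exact exists_splitting_of_not_summable_posPart hpos
end

section
/- Let u be a unitary operator on ℓ²(ℕ, ℂ) such that 1 − u is a compact operator. Then for every ε > 0 there exist a natural number n and a unitary operator w on ℓ²(ℕ, ℂ) such that w e_k = e_k for all k ≥ n (where (e_k) is the standard orthonormal basis, so that w − 1 has finite rank) and ‖u − w‖ < ε in operator norm. In other words, the group of unitaries of the form (finite-dimensional unitary) ⊕ 1 is dense, in the operator-norm topology, in the group U(ℓ²ℕ)_K := {u unitary : 1 − u compact}. -/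
/- Statement 10: the unitaries of the form (finite-dimensional unitary) ⊕ 1 are dense, in the
operator norm, in the group `U(ℓ²ℕ)_K` of unitaries `u` with `1 - u` compact. -/

noncomputable section

open Filter Topology

/-- A selfadjoint element close to `1` has a selfadjoint inverse square root close to `1`. -/
theorem IsSelfAdjoint.exists_inv_sqrt {A : Type*} [CStarAlgebra A] [Nontrivial A] {x : A}
    (hx : IsSelfAdjoint x) (hx1 : ‖x - 1‖ ≤ 1 / 2) :
    ∃ g : A, IsSelfAdjoint g ∧ g * g * x = 1 ∧ g * x * g = 1 ∧ ‖g - 1‖ ≤ ‖x - 1‖ := by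
  set f : ℝ → ℝ := fun t => (√t)⁻¹
  have hspec : ∀ t ∈ spectrum ℝ x, |t - 1| ≤ ‖x - 1‖ := by
    intro t ht
    have h : t - 1 ∈ spectrum ℝ (x - 1) := by
      have h := (spectrum.add_mem_iff (R := ℝ) (a := x) (s := 1) (r := t - 1)).1 (by simpa using ht)
      rwa [map_one, neg_add_eq_sub] at h
    simpa using spectrum.norm_le_norm_of_mem h
  have hpos : ∀ t ∈ spectrum ℝ x, 1 / 2 ≤ t := fun t ht => by
    have := (abs_le.1 ((hspec t ht).trans hx1)).1
    linarith
  have hf : ContinuousOn f (spectrum ℝ x) :=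
    Real.continuous_sqrt.continuousOn.inv₀ fun t ht =>
      (Real.sqrt_pos.2 (by linarith [hpos t ht])).ne'
  have hid : cfc (fun t : ℝ => t) x = x := cfc_id' ℝ x
  have hinv : ∀ t ∈ spectrum ℝ x, f t * f t * t = 1 := fun t ht => by
    have ht0 : 0 < t := by linarith [hpos t ht]
    have hs := Real.mul_self_sqrt ht0.le
    have hs0 := Real.sqrt_pos.2 ht0
    simp only [f]
    field_simp
    nlinarith
  refine ⟨cfc f x, cfc_predicate f x, ?_, ?_, ?_⟩
  · rw [← cfc_const_one ℝ x, ← cfc_congr hinv,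
      cfc_mul (fun t => f t * f t) (fun t => t) x (hf.mul hf), cfc_mul f f x, hid]
  · have h : Set.EqOn (fun t => f t * t * f t) (fun _ => 1) (spectrum ℝ x) := fun t ht => by
      rw [← hinv t ht]; ring
    rw [← cfc_const_one ℝ x, ← cfc_congr h, cfc_mul (fun t => f t * t) f x (hf.mul continuousOn_id),
      cfc_mul f (fun t => t) x, hid]
  · rw [← cfc_const_one ℝ x, ← cfc_sub f (fun _ => 1) x, cfc_const_one ℝ x]
    refine norm_cfc_le (norm_nonneg _) fun t ht => le_trans ?_ (hspec t ht)
    have ht0 : 1 / 2 ≤ t := hpos t ht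
    have hs := Real.mul_self_sqrt (show 0 ≤ t by linarith)
    have hs0 : 1 / 2 ≤ √t := Real.le_sqrt_of_sq_le (by linarith)
    have key : f t - 1 = (1 - t) * (√t * (1 + √t))⁻¹ := by
      simp only [f]
      field_simp
      nlinarith
    rw [key, Real.norm_eq_abs, abs_mul, abs_sub_comm 1 t]
    refine mul_le_of_le_one_right (abs_nonneg _) ?_
    rw [abs_of_nonneg (by positivity)]
    exact inv_le_one_of_one_le₀ (by nlinarith)

/-- An isometry at distance less than `1` from a unitary is unitary. -/
theorem mem_unitary_of_star_mul_self_of_norm_sub_lt {A : Type*} [CStarAlgebra A]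
    {u w : A} (hu : u ∈ unitary A) (hw : star w * w = 1) (huw : ‖u - w‖ < 1) : w ∈ unitary A := by
  have h1 : ‖star u * (u - w)‖ < 1 := by
    rwa [CStarRing.norm_mem_unitary_mul _ (Unitary.star_mem hu)]
  have h2 : w = u * (1 - star u * (u - w)) := by
    rw [mul_sub, ← mul_assoc, Unitary.mul_star_self_of_mem hu]
    noncomm_ring
  have h3 : IsUnit w := by
    rw [h2]
    exact (isUnit_iff_exists.2 ⟨star u, Unitary.mul_star_self_of_mem hu,
      Unitary.star_mul_self_of_mem hu⟩).mul (isUnit_one_sub_of_norm_lt_one h1)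
  obtain ⟨v, rfl⟩ := h3
  refine Unitary.mem_iff.2 ⟨hw, ?_⟩
  rw [← Units.inv_eq_of_mul_eq_one_left hw, v.mul_inv]

/-- The unitary part of the polar decomposition of an element near a unitary. -/
theorem exists_unitary_mul_near {A : Type*} [CStarAlgebra A] [Nontrivial A] {u a : A}
    (hu : u ∈ unitary A) {δ : ℝ} (hδ : δ ≤ 1 / 6) (ha : ‖u - a‖ ≤ δ) :
    ∃ g : A, a * g ∈ unitary A ∧ g * g * (star a * a) = 1 ∧ ‖g - 1‖ < 1 ∧ ‖u - a * g‖ ≤ 5 * δ := by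
  have hδ0 : 0 ≤ δ := (norm_nonneg _).trans ha
  have hun : ‖u‖ = 1 := CStarRing.norm_of_mem_unitary hu
  have han : ‖a‖ ≤ 1 + δ := by
    have := norm_sub_norm_le a u
    rw [norm_sub_rev] at this
    linarith
  have hx1 : ‖star a * a - 1‖ ≤ 3 * δ := by
    have h : star a * a - 1 = -(star a * (u - a) + star (u - a) * u) := by
      rw [← Unitary.star_mul_self_of_mem hu, star_sub]
      noncomm_ring
    rw [h, norm_neg]
    calc _ ≤ ‖star a‖ * ‖u - a‖ + ‖star (u - a)‖ * ‖u‖ :=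
          (norm_add_le _ _).trans (add_le_add (norm_mul_le _ _) (norm_mul_le _ _))
      _ ≤ (1 + δ) * δ + δ * 1 := by rw [norm_star, norm_star, hun]; gcongr
      _ ≤ 3 * δ := by nlinarith
  obtain ⟨g, hg, hgx, hgxg, hg1⟩ :=
    (IsSelfAdjoint.star_mul_self a).exists_inv_sqrt (by linarith)
  have hdist : ‖u - a * g‖ ≤ 5 * δ := by
    have h : u - a * g = (u - a) - a * (g - 1) := by noncomm_ring
    rw [h]
    calc _ ≤ ‖u - a‖ + ‖a‖ * ‖g - 1‖ :=
          (norm_sub_le _ _).trans (add_le_add le_rfl (norm_mul_le _ _))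
      _ ≤ δ + (1 + δ) * (3 * δ) := by gcongr; exact hg1.trans hx1
      _ ≤ 5 * δ := by nlinarith
  refine ⟨g, mem_unitary_of_star_mul_self_of_norm_sub_lt hu ?_ (by linarith), hgx,
    by linarith, hdist⟩
  rw [star_mul, hg.star_eq, ← hgxg]
  noncomm_ring

/-- A bounded operator strictly closer than `1` to the identity whose square fixes `v` fixes `v`. -/
theorem ContinuousLinearMap.eq_self_of_mul_self_apply {E : Type*} [NormedAddCommGroup E]
    [NormedSpace ℂ E] {g : E →L[ℂ] E} (hg : ‖g - 1‖ < 1) {v : E} (hv : g (g v) = v) : g v = v := by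
  by_contra hne
  set y := g v - v with hy
  have hy0 : 0 < ‖y‖ := norm_pos_iff.2 (sub_ne_zero.2 hne)
  have hgy : (g - 1) y = -((2 : ℂ) • y) := by
    have h : (g - 1) y = g y - y := rfl
    have h' : g y = v - g v := by rw [hy, map_sub, hv]
    rw [h, h', hy]
    module
  have h := (g - 1).le_opNorm y
  rw [hgy, norm_neg, norm_smul] at h
  norm_num at h
  nlinarith

/-- Uniformly bounded operators tending strongly to zero tend to zero in norm after composition
with a compact operator. -/
theorem IsCompactOperator.tendsto_norm_comp_zero {E : Type*} [NormedAddCommGroup E]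
    [NormedSpace ℂ E] {K : E →L[ℂ] E} (hK : IsCompactOperator K) {Q : ℕ → E →L[ℂ] E}
    (hQ : ∀ n, ‖Q n‖ ≤ 1) (hQ0 : ∀ x, Tendsto (fun n => Q n x) atTop (𝓝 0)) :
    Tendsto (fun n => ‖Q n * K‖) atTop (𝓝 0) := by
  rw [Metric.tendsto_atTop]
  intro ε hε
  have hc := IsCompactOperator.isCompact_closure_image_closedBall (f := (K : E →ₗ[ℂ] E)) hK 1
  obtain ⟨t, -, htf, ht⟩ := hc.finite_cover_balls (show 0 < ε / 3 by linarith)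
  have hev : ∀ᶠ n in atTop, ∀ y ∈ t, ‖Q n y‖ < ε / 3 := by
    refine (eventually_all_finite htf).2 fun y _ => ?_
    exact (hQ0 y).norm.eventually_lt_const (by rw [norm_zero]; linarith)
  obtain ⟨N, hN⟩ := eventually_atTop.1 hev
  refine ⟨N, fun n hn => ?_⟩
  rw [dist_zero_right, norm_norm]
  refine lt_of_le_of_lt (b := 2 * (ε / 3)) ?_ (by linarith)
  refine ContinuousLinearMap.opNorm_le_of_unit_norm (by linarith) fun x hx => ?_
  have hmem : K x ∈ closure ((K : E →ₗ[ℂ] E) '' Metric.closedBall 0 1) :=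
    subset_closure ⟨x, by simp [hx], rfl⟩
  obtain ⟨y, hy, hxy⟩ := Set.mem_iUnion₂.1 (ht hmem)
  rw [Metric.mem_ball, dist_eq_norm] at hxy
  have h : (Q n * K) x = Q n (K x - y) + Q n y := by simp
  rw [h]
  calc _ ≤ ‖Q n (K x - y)‖ + ‖Q n y‖ := norm_add_le _ _
    _ ≤ 1 * ‖K x - y‖ + ε / 3 := by
        gcongr
        · exact (Q n).le_of_opNorm_le (hQ n) _
        · exact (hN n hn y hy).le
    _ ≤ 2 * (ε / 3) := by linarith

instance : Nontrivial H := ⟨e 0, 0, fun h => by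
  simpa [e] using congrArg (fun x : H => x 0) h⟩

/-- The span of the first `n` standard basis vectors. -/
def initialSpan (n : ℕ) : Submodule ℂ H := Submodule.span ℂ (e '' Set.Iio n)

instance (n : ℕ) : FiniteDimensional ℂ (initialSpan n) :=
  FiniteDimensional.span_of_finite ℂ ((Set.finite_Iio n).image e)

theorem initialSpan_mono : Monotone initialSpan := fun _ _ h =>
  Submodule.span_mono (Set.image_mono (Set.Iio_subset_Iio h))

theorem mem_initialSpan {k n : ℕ} (h : k < n) : e k ∈ initialSpan n :=
  Submodule.subset_span ⟨k, h, rfl⟩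

theorem starProjection_initialSpan_apply {k n : ℕ} (h : n ≤ k) :
    (initialSpan n).starProjection (e k) = 0 := by
  rw [Submodule.starProjection_apply_eq_zero_iff, Submodule.mem_orthogonal]
  intro x hx
  induction hx using Submodule.span_induction with
  | mem x hx =>
    obtain ⟨i, hi, rfl⟩ := hx
    have hik : i ≠ k := ((Set.mem_Iio.1 hi).trans_le h).ne
    simp [e, lp.inner_single_left, lp.single_apply, hik]
  | zero => simp
  | add x y _ _ hx hy => rw [inner_add_left, hx, hy, add_zero]
  | smul c x _ hx => rw [inner_smul_left, hx, mul_zero]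

theorem tendsto_starProjection_initialSpan (x : H) :
    Tendsto (fun n => (initialSpan n).starProjection x) atTop (𝓝 x) := by
  refine Submodule.starProjection_tendsto_self initialSpan initialSpan_mono x fun y _ => ?_
  refine mem_closure_of_tendsto (lp.hasSum_single (p := 2) (by simp) y) (Eventually.of_forall ?_)
  intro s
  refine Submodule.sum_mem _ fun i _ => ?_
  have h : lp.single 2 i (y i) = y i • e i := by
    rw [e, ← lp.single_smul, smul_eq_mul, mul_one]
  rw [h]
  exact Submodule.smul_mem _ _
    (Submodule.mem_iSup_of_mem (i + 1) (mem_initialSpan (Nat.lt_succ_self i)))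

/-- Compressions of a compact operator with compact adjoint to the initial spans converge. -/
theorem tendsto_norm_sub_compression {K : H →L[ℂ] H} (hK : IsCompactOperator K)
    (hK' : IsCompactOperator ⇑(star K)) :
    Tendsto (fun n => ‖K - (initialSpan n).starProjection * K * (initialSpan n).starProjection‖)
      atTop (𝓝 0) := by
  set P : ℕ → H →L[ℂ] H := fun n => (initialSpan n).starProjection
  have hPn : ∀ n, ‖P n‖ ≤ 1 := fun n => Submodule.starProjection_norm_le _
  have hPs : ∀ n, star (P n) = P n := fun n => (isSelfAdjoint_starProjection _).star_eq
  have hQ : ∀ n, ‖1 - P n‖ ≤ 1 := fun n => by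
    have h : 1 - P n = (initialSpan n)ᗮ.starProjection := by
      rw [Submodule.starProjection_orthogonal]; rfl
    rw [h]
    exact Submodule.starProjection_norm_le _
  have hQ0 : ∀ x, Tendsto (fun n => (1 - P n) x) atTop (𝓝 0) := fun x => by
    simpa using (tendsto_starProjection_initialSpan x).const_sub x
  have h := (hK.tendsto_norm_comp_zero hQ hQ0).add (hK'.tendsto_norm_comp_zero hQ hQ0)
  rw [add_zero] at h
  refine squeeze_zero (fun _ => norm_nonneg _) (fun n => ?_) h
  have h1 : K - P n * K * P n = (1 - P n) * K + P n * star ((1 - P n) * star K) := by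
    rw [star_mul, star_star, star_sub, star_one, hPs]
    noncomm_ring
  change ‖K - P n * K * P n‖ ≤ _
  rw [h1]
  refine (norm_add_le _ _).trans (add_le_add le_rfl ((norm_mul_le _ _).trans ?_))
  exact (mul_le_of_le_one_left (norm_nonneg _) (hPn n)).trans_eq
    (norm_star ((1 - P n) * star K : H →L[ℂ] H))

theorem dense_finiteRank_unitaries
    (u : H →L[ℂ] H) (hu : u ∈ unitary (H →L[ℂ] H))
    (hcpt : IsCompactOperator (⇑((1 : H →L[ℂ] H) - u))) :
    ∀ ε : ℝ, 0 < ε →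
      ∃ (n : ℕ) (w : H →L[ℂ] H), w ∈ unitary (H →L[ℂ] H) ∧
        (∀ k, n ≤ k → w (e k) = e k) ∧ ‖u - w‖ < ε := by
  intro ε hε
  have hcpt' : IsCompactOperator ⇑(star (1 - u)) := by
    have h : star (1 - u) = -(star u * (1 - u)) := by
      rw [mul_sub, Unitary.star_mul_self_of_mem hu, star_sub, star_one]
      noncomm_ring
    rw [h]
    exact (hcpt.clm_comp (star u)).neg
  obtain ⟨n, hn⟩ := ((tendsto_norm_sub_compression hcpt hcpt').eventually_lt_const
    (show 0 < min (1 / 6) (ε / 6) by positivity)).exists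
  set P := (initialSpan n).starProjection
  have hPs : star P = P := (isSelfAdjoint_starProjection _).star_eq
  set a : H →L[ℂ] H := 1 - P * (1 - u) * P with ha
  have hua : ‖u - a‖ ≤ min (1 / 6) (ε / 6) := by
    have h : u - a = -((1 - u) - P * (1 - u) * P) := by rw [ha]; abel
    rw [h, norm_neg]
    exact hn.le
  obtain ⟨g, hw, hgx, hg1, hdist⟩ := exists_unitary_mul_near hu (min_le_left _ _) hua
  refine ⟨n, a * g, hw, fun k hk => ?_, hdist.trans_lt ?_⟩
  · have hPe : P (e k) = 0 := starProjection_initialSpan_apply hk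
    have hae : a (e k) = e k := by simp [ha, hPe]
    have hae' : (star a) (e k) = e k := by
      rw [ha, star_sub, star_one, star_mul, star_mul, hPs]
      simp [hPe]
    have hgg : g (g (e k)) = e k := by
      have := congrArg (fun T : H →L[ℂ] H => T (e k)) hgx
      simpa [hae, hae'] using this
    rw [mul_apply_eq_comp, ContinuousLinearMap.eq_self_of_mul_self_apply hg1 hgg, hae]
  · linarith [min_le_right (1 / 6) (ε / 6)]
end
end

section
/- The group U(ℓ²ℕ)_K := {u unitary on ℓ²(ℕ,ℂ) : 1 − u compact} has trivial center: if u is a unitary operator on ℓ²(ℕ, ℂ) with 1 − u compact and u commutes with every unitary operator w on ℓ²(ℕ, ℂ) for which 1 − w is compact, then u = 1. -/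
/- Statement 11: the group `U(ℓ²ℕ)_K` of unitaries `u` on `ℓ²(ℕ, ℂ)` with `1 - u` compact has
trivial center. -/

noncomputable section

open Submodule in
/-- The reflection through the orthogonal complement of a finite-dimensional subspace is a compact
perturbation of the identity. -/
theorem isCompactOperator_one_sub_reflection_orthogonal {𝕜 E : Type*} [RCLike 𝕜]
    [NormedAddCommGroup E] [InnerProductSpace 𝕜 E] (K : Submodule 𝕜 E) [FiniteDimensional 𝕜 K] :
    IsCompactOperator
      (⇑((1 : E →L[𝕜] E) - (Kᗮ.reflection.toContinuousLinearEquiv : E →L[𝕜] E))) := by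
  have : ProperSpace K := FiniteDimensional.proper_rclike 𝕜 K
  have h := (isCompactOperator_of_locallyCompactSpace_rng K.subtypeL).comp_clm
    ((2 : 𝕜) • K.orthogonalProjectionOnto)
  refine (congrArg IsCompactOperator (funext fun x ↦ ?_)).mp h
  simp [reflection_apply, two_smul]
  abel

/-- A bounded operator commuting with every unitary compact perturbation of the identity is a
scalar. -/
theorem ContinuousLinearMap.exists_eq_smul_one_of_forall_unitary_commute {𝕜 E : Type*} [RCLike 𝕜]
    [NormedAddCommGroup E] [InnerProductSpace 𝕜 E] [CompleteSpace E] (u : E →L[𝕜] E)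
    (hcomm : ∀ w : E →L[𝕜] E, w ∈ unitary (E →L[𝕜] E) →
      IsCompactOperator (⇑((1 : E →L[𝕜] E) - w)) → u * w = w * u) :
    ∃ c : 𝕜, u = c • (1 : E →L[𝕜] E) := by
  have hspan (v : E) : u v ∈ Submodule.span 𝕜 {v} := by
    set K := Submodule.span 𝕜 {v}
    have hw := hcomm (Kᗮ.reflection.toContinuousLinearEquiv : E →L[𝕜] E)
      (Unitary.linearIsometryEquiv.symm Kᗮ.reflection).2
      (isCompactOperator_one_sub_reflection_orthogonal K)
    have hv : v ∈ K := Submodule.mem_span_singleton_self v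
    have h : -u v = Kᗮ.reflection (u v) := by
      simpa [Submodule.reflection_orthogonal_apply, Submodule.reflection_mem_subspace_eq_self hv]
        using DFunLike.congr_fun hw v
    rw [Submodule.reflection_orthogonal_apply, neg_inj] at h
    exact (Submodule.reflection_eq_self_iff _).mp h.symm
  obtain ⟨c, hc⟩ := u.toLinearMap.exists_eq_smul_id_of_forall_notLinearIndependent fun v hv ↦ by
    obtain ⟨a, ha⟩ := Submodule.mem_span_singleton.mp (hspan v)
    rw [LinearIndependent.pair_iff] at hv
    simpa using hv a (-1) (by simp [ha])
  exact ⟨c, ContinuousLinearMap.ext fun x ↦ DFunLike.congr_fun hc x⟩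

theorem not_finiteDimensional_H : ¬ FiniteDimensional ℂ H := fun _ ↦
  have := (default : HilbertBasis ℕ ℂ H).orthonormal.linearIndependent.finite
  not_finite ℕ

theorem center_unitaryCompact_trivial
    (u : H →L[ℂ] H) (hu : u ∈ unitary (H →L[ℂ] H))
    (hcpt : IsCompactOperator (⇑((1 : H →L[ℂ] H) - u)))
    (hcomm : ∀ w : H →L[ℂ] H, w ∈ unitary (H →L[ℂ] H) →
      IsCompactOperator (⇑((1 : H →L[ℂ] H) - w)) → u * w = w * u) :
    u = 1 := by
  obtain ⟨c, rfl⟩ := u.exists_eq_smul_one_of_forall_unitary_commute hcomm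
  by_contra hne
  have hc : 1 - c ≠ 0 := fun h ↦ hne (by rw [← sub_eq_zero.mp h, one_smul])
  refine not_finiteDimensional_H (.of_isCompactOperator_id ((IsCompactOperator.smul_iff₀ hc).mp ?_))
  refine (congrArg IsCompactOperator (funext fun x ↦ ?_)).mp hcpt
  simp [sub_smul]
end
end
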